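/- The optimal cost of the remote estimation problem equals the optimal cost of the deterministic control problem: the infimum over all pairs (f, g) of J(f, g) is attained and equals min over admissible control sequences u of J^d(u). -/

import Mathlib

open scoped ENNReal

noncomputable section

abbrev Euc (n : ℕ) := EuclideanSpace ℝ (Fin n)

variable {n : ℕ}

/-- Source trajectory: `X_1 = n_1`, `X_{t+1} = λ A X_t + n_{t+1}` (0-indexed). -/
def srcX (lam : ℝ) (A : Euc n ≃ₗᵢ[ℝ] Euc n) (ν : ℕ → Euc n) : ℕ → Euc n
  | 0 => ν 0
  | t + 1 => lam • A (srcX lam A ν t) + ν (t + 1)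

/-- Admissible noise sequences: `‖n_t‖ ≤ a_t` throughout the horizon. -/
def Noise (n : ℕ) (T : ℕ) (a : ℕ → ℝ) : Set (ℕ → Euc n) := {ν | ∀ t < T, ‖ν t‖ ≤ a t}

/-- A transmission strategy, encoded by the transmission decisions it induces on
noise realizations.  `adapted` says the decision at time `t` is a function of the
information `(X_{1:t}, E_{1:t}, Y_{1:t-1})` available to the sensor (equivalently,
since the energy levels and channel outputs are themselves determined by `X_{1:t}`
and the strategy, a function of `X_{1:t}`); `energy_ok` says a transmission can
occur only when the remaining energy `E_t = K − Σ_{i<t} U_i` is positive. -/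
structure TxStrategy (lam : ℝ) (A : Euc n ≃ₗᵢ[ℝ] Euc n) (T K : ℕ) where
  U : (ℕ → Euc n) → ℕ → Bool
  energy_ok : ∀ ν t, t < T → U ν t = true →
    (∑ i ∈ Finset.range t, (if U ν i then 1 else 0)) < K
  adapted : ∀ ν ν' t, t < T →
    (∀ i ≤ t, srcX lam A ν i = srcX lam A ν' i) → U ν t = U ν' t

/-- Channel output: `Y_t = X_t` if `U_t = 1`, and `Y_t = ε` (i.e. `none`) otherwise. -/
def chOut (lam : ℝ) (A : Euc n ≃ₗᵢ[ℝ] Euc n) (U : (ℕ → Euc n) → ℕ → Bool)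
    (ν : ℕ → Euc n) (t : ℕ) : Option (Euc n) :=
  if U ν t then some (srcX lam A ν t) else none

/-- An estimation strategy: `X̂_t = g_t(Y_{1:t})`. -/
def EstStrategy (n : ℕ) : Type := (t : ℕ) → (Fin (t + 1) → Option (Euc n)) → Euc n

/-- Worst-case maximum instantaneous estimation error
`J(f, g) = sup_{noise} max_{1≤t≤T} ‖X_t − X̂_t‖` (valued in `ℝ≥0∞`). -/
def Jcost (lam : ℝ) (A : Euc n ≃ₗᵢ[ℝ] Euc n) (T K : ℕ) (a : ℕ → ℝ)
    (f : TxStrategy lam A T K) (g : EstStrategy n) : ℝ≥0∞ :=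
  ⨆ ν ∈ Noise n T a, ⨆ t : Fin T,
    ENNReal.ofReal ‖srcX lam A ν t - g t (fun i => chOut lam A f.U ν i)‖




/-- Deterministic state: `X^d_1 = a_1` (index 0) and
`X^d_{t+1} = a_{t+1}` if `u_t = 1`, `X^d_{t+1} = |λ| X^d_t + a_{t+1}` if `u_t = 0`.
(Everything is 0-indexed: `a i` is the paper's `a_{i+1}` and `u i` the paper's `u_{i+1}`.) -/
def Xd (lam : ℝ) (a : ℕ → ℝ) (u : ℕ → Bool) : ℕ → ℝ
  | 0 => a 0
  | t + 1 => if u t then a (t + 1) else |lam| * Xd lam a u t + a (t + 1)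

/-- Admissible control sequences: at most `K` transmissions within the horizon. -/
def Adm (T K : ℕ) (u : ℕ → Bool) : Prop :=
  (∑ t ∈ Finset.range T, (if u t then 1 else 0)) ≤ K

/-- Cost of the deterministic control problem:
`J^d(u) = max_{1≤t≤T} ρ_t`, `ρ_t = X^d_t` if `u_t = 0` and `ρ_t = 0` if `u_t = 1`. -/
def Jd (lam : ℝ) (a : ℕ → ℝ) (T : ℕ) (u : ℕ → Bool) : ℝ :=
  ⨆ t : Fin T, (if u t then 0 else Xd lam a u t)

section DeterministicProblem

variable {lam : ℝ} {a : ℕ → ℝ}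

lemma Xd_congr {u v : ℕ → Bool} : ∀ {t : ℕ}, (∀ i < t, u i = v i) →
    Xd lam a u t = Xd lam a v t
  | 0, _ => rfl
  | t + 1, h => by
    simp only [Xd, h t (Nat.lt_succ_self t), Xd_congr (t := t) fun i hi => h i (by omega)]

lemma Xd_nonneg (ha : ∀ t, 0 ≤ a t) (u : ℕ → Bool) : ∀ t, 0 ≤ Xd lam a u t
  | 0 => ha 0
  | t + 1 => by
    have := Xd_nonneg ha u t
    have := ha (t + 1)
    simp only [Xd]
    split_ifs <;> positivity

lemma Jd_congr {T : ℕ} {u v : ℕ → Bool} (h : ∀ i < T, u i = v i) :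
    Jd lam a T u = Jd lam a T v := by
  unfold Jd
  congr 1
  funext t
  rw [h t t.2, Xd_congr fun i hi => h i (hi.trans t.2)]

lemma Adm_congr {T K : ℕ} {u v : ℕ → Bool} (h : ∀ i < T, u i = v i) :
    Adm T K u ↔ Adm T K v := by
  unfold Adm
  rw [Finset.sum_congr rfl fun i hi => by rw [h i (Finset.mem_range.1 hi)]]

lemma le_Jd {T t : ℕ} (u : ℕ → Bool) (ht : t < T) :
    (if u t then 0 else Xd lam a u t) ≤ Jd lam a T u :=
  le_ciSup (f := fun t : Fin T => if u t then 0 else Xd lam a u t)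
    (Set.finite_range _).bddAbove ⟨t, ht⟩

lemma exists_optimal_control (lam : ℝ) (a : ℕ → ℝ) (T K : ℕ) :
    ∃ u, Adm T K u ∧ ∀ u', Adm T K u' → Jd lam a T u ≤ Jd lam a T u' := by
  let extend : (Fin T → Bool) → ℕ → Bool := fun w i => if h : i < T then w ⟨i, h⟩ else false
  obtain ⟨w, hw, hmin⟩ := Set.exists_min_image {w | Adm T K (extend w)}
    (fun w => Jd lam a T (extend w)) (Set.toFinite _)
    ⟨fun _ => false, by simp [Adm, extend]⟩
  refine ⟨extend w, hw, fun u' hu' => ?_⟩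
  have heq : ∀ i < T, u' i = extend (fun j => u' j) i := fun i hi => by simp [extend, hi]
  rw [Jd_congr heq]
  exact hmin (fun j => u' j) ((Adm_congr heq).1 hu')

end DeterministicProblem

section OpenLoop

variable {lam : ℝ} {A : Euc n ≃ₗᵢ[ℝ] Euc n} {T K : ℕ} {a : ℕ → ℝ}

/-- The strategy that transmits at the times prescribed by a control sequence. -/
def openLoopTx (lam : ℝ) (A : Euc n ≃ₗᵢ[ℝ] Euc n) {T K : ℕ} {u : ℕ → Bool}
    (hu : Adm T K u) : TxStrategy lam A T K where
  U _ t := u t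
  energy_ok _ t ht hut := by
    have hle := (Finset.sum_le_sum_of_subset (f := fun i => if u i then 1 else 0)
      (Finset.range_subset_range.2 (Nat.succ_le_of_lt ht))).trans hu
    rw [Finset.sum_range_succ, if_pos hut] at hle
    exact hle
  adapted _ _ _ _ _ := rfl

/-- The last received state, propagated through the noiseless dynamics. -/
def propagate (lam : ℝ) (A : Euc n ≃ₗᵢ[ℝ] Euc n) (y : ℕ → Option (Euc n)) : ℕ → Euc n
  | 0 => (y 0).getD 0
  | t + 1 => (y (t + 1)).getD (lam • A (propagate lam A y t))

/-- The estimation strategy given by `propagate`. -/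
def propagateEst (lam : ℝ) (A : Euc n ≃ₗᵢ[ℝ] Euc n) : EstStrategy n :=
  fun t y => propagate lam A (fun i => if h : i < t + 1 then y ⟨i, h⟩ else none) t

lemma norm_sub_propagate_le {u : ℕ → Bool} {ν : ℕ → Euc n}
    (hν : ν ∈ Noise n T a) {y : ℕ → Option (Euc n)} :
    ∀ {t : ℕ}, t < T → (∀ i ≤ t, y i = chOut lam A (fun _ => u) ν i) →
      ‖srcX lam A ν t - propagate lam A y t‖ ≤ if u t then 0 else Xd lam a u t
  | 0, ht, hy => by
    have h0 := hν 0 ht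
    cases h : u 0 <;> simp [propagate, hy 0 le_rfl, chOut, h, srcX, Xd, h0]
  | t + 1, ht, hy => by
    have ih := norm_sub_propagate_le hν (t := t) (by omega) fun i hi => hy i (by omega)
    have h1 := hν (t + 1) ht
    cases h : u (t + 1)
    · have hdiff : srcX lam A ν (t + 1) - propagate lam A y (t + 1) =
          lam • A (srcX lam A ν t - propagate lam A y t) + ν (t + 1) := by
        simp only [propagate, hy _ le_rfl, chOut, h, srcX, map_sub, smul_sub,
          Bool.false_eq_true, if_false, Option.getD_none]
        abel
      have hnorm : ‖srcX lam A ν (t + 1) - propagate lam A y (t + 1)‖ ≤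
          |lam| * ‖srcX lam A ν t - propagate lam A y t‖ + a (t + 1) := by
        rw [hdiff]
        refine (norm_add_le _ _).trans (add_le_add ?_ h1)
        rw [norm_smul, A.norm_map, Real.norm_eq_abs]
      have hmul := mul_le_mul_of_nonneg_left ih (abs_nonneg lam)
      cases h' : u t <;> simp [h', Xd] at hmul ⊢ <;> linarith
    · simp [propagate, hy (t + 1) le_rfl, chOut, h]

lemma Jcost_openLoop_le {u : ℕ → Bool} (hu : Adm T K u) :
    Jcost lam A T K a (openLoopTx lam A hu) (propagateEst lam A) ≤
      ENNReal.ofReal (Jd lam a T u) := by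
  refine iSup₂_le fun ν hν => iSup_le fun t => ENNReal.ofReal_le_ofReal ?_
  refine (norm_sub_propagate_le hν t.2 fun i hi => ?_).trans (le_Jd u t.2)
  simp [Nat.lt_succ_of_le hi, openLoopTx]

end OpenLoop

section LowerBound

variable {lam : ℝ} {A : Euc n ≃ₗᵢ[ℝ] Euc n} {T K : ℕ} {a : ℕ → ℝ}

lemma srcX_congr {ν ν' : ℕ → Euc n} :
    ∀ {t : ℕ}, (∀ i ≤ t, ν i = ν' i) → srcX lam A ν t = srcX lam A ν' t
  | 0, h => h 0 le_rfl
  | t + 1, h => by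
    simp only [srcX, h _ le_rfl, srcX_congr (t := t) fun i hi => h i (by omega)]

/-- The image of `e` under the rotational part of the dynamics, iterated `t` times. -/
def direction (lam : ℝ) (A : Euc n ≃ₗᵢ[ℝ] Euc n) (e : Euc n) : ℕ → Euc n
  | 0 => e
  | t + 1 => (if lam < 0 then (-1 : ℝ) else 1) • A (direction lam A e t)

lemma norm_direction (e : Euc n) : ∀ t, ‖direction lam A e t‖ = ‖e‖
  | 0 => rfl
  | t + 1 => by
    rw [direction, norm_smul, A.norm_map, norm_direction e t]
    split_ifs <;> simp

lemma smul_map_direction (e : Euc n) (t : ℕ) :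
    lam • A (direction lam A e t) = |lam| • direction lam A e (t + 1) := by
  rw [direction, smul_smul]
  congr 1
  split_ifs with h
  · rw [abs_of_neg h]; ring
  · rw [abs_of_nonneg (not_lt.1 h), mul_one]

/-- Follow `ν` before time `r`, then the noise `c a_t` times the rotated direction `e`. -/
def pushNoise (lam : ℝ) (A : Euc n ≃ₗᵢ[ℝ] Euc n) (a : ℕ → ℝ) (ν : ℕ → Euc n) (r : ℕ)
    (e : Euc n) (c : ℝ) (i : ℕ) : Euc n :=
  if i < r then ν i else (c * a i) • direction lam A e i

lemma pushNoise_mem {ν : ℕ → Euc n} (hν : ν ∈ Noise n T a) (ha : ∀ t, 0 ≤ a t) (r : ℕ)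
    {e : Euc n} (he : ‖e‖ = 1) {c : ℝ} (hc : |c| = 1) :
    pushNoise lam A a ν r e c ∈ Noise n T a := by
  intro t ht
  unfold pushNoise
  split_ifs
  · exact hν t ht
  · rw [norm_smul, norm_direction, he, Real.norm_eq_abs, abs_mul, hc, abs_of_nonneg (ha t)]
    simp

lemma srcX_pushNoise_of_lt (ν : ℕ → Euc n) {r i : ℕ} (hi : i < r) (e : Euc n) (c : ℝ) :
    srcX lam A (pushNoise lam A a ν r e c) i = srcX lam A ν i :=
  srcX_congr fun _ hj => if_pos (hj.trans_lt hi)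

lemma srcX_pushNoise_sub (ν : ℕ → Euc n) {r : ℕ} (e : Euc n) {u : ℕ → Bool}
    (hr : ∀ j, j + 1 = r → u j = true) :
    ∀ {t : ℕ}, r ≤ t → (∀ i, r ≤ i → i < t → u i = false) →
      srcX lam A (pushNoise lam A a ν r e 1) t - srcX lam A (pushNoise lam A a ν r e (-1)) t =
        (2 * Xd lam a u t) • direction lam A e t
  | 0, hrt, _ => by
    obtain rfl : r = 0 := by omega
    simp only [srcX, pushNoise, lt_irrefl, if_false, Xd, ← sub_smul]
    congr 1
    ring
  | t + 1, hrt, hu => by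
    have hstep : srcX lam A (pushNoise lam A a ν r e 1) (t + 1) -
        srcX lam A (pushNoise lam A a ν r e (-1)) (t + 1) =
        lam • A (srcX lam A (pushNoise lam A a ν r e 1) t -
          srcX lam A (pushNoise lam A a ν r e (-1)) t) +
          (2 * a (t + 1)) • direction lam A e (t + 1) := by
      simp only [srcX, pushNoise, not_lt.2 hrt, if_false, map_sub]
      module
    rw [hstep]
    rcases hrt.eq_or_lt with h | h
    · rw [srcX_pushNoise_of_lt ν (by omega), srcX_pushNoise_of_lt ν (by omega)]
      simp [Xd, hr t h.symm]
    · rw [srcX_pushNoise_sub ν e hr (t := t) (by omega) fun i h1 h2 => hu i h1 (by omega),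
        map_smul, smul_comm, smul_map_direction, Xd, hu t (by omega) (by omega)]
      simp only [Bool.false_eq_true, if_false]
      module

/-- If all continuations of `ν` from time `r` on stay silent up to time `t`, then
a guaranteed error `D` is at least the deterministic state. -/
lemma Xd_le_of_silent (hn : 1 ≤ n) (ha : ∀ t, 0 ≤ a t) {f : TxStrategy lam A T K}
    {g : EstStrategy n} {D : ℝ}
    (hD : ∀ ν ∈ Noise n T a, ∀ t < T,
      ‖srcX lam A ν t - g t (fun i => chOut lam A f.U ν i)‖ ≤ D)
    {ν : ℕ → Euc n} (hν : ν ∈ Noise n T a) {r t : ℕ} (hrt : r ≤ t) (ht : t < T)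
    (hr : ∀ j, j + 1 = r → f.U ν j = true)
    (hsilent : ∀ i, r ≤ i → i ≤ t → f.U ν i = false)
    (hfresh : ∀ ν' ∈ Noise n T a, (∀ i < r, ν' i = ν i) → ∀ i ≤ t, f.U ν' i = f.U ν i) :
    Xd lam a (f.U ν) t ≤ D := by
  have : Nonempty (Fin n) := ⟨⟨0, hn⟩⟩
  obtain ⟨e, he⟩ := exists_norm_eq (Euc n) zero_le_one
  have hmem : ∀ {c : ℝ}, |c| = 1 → pushNoise lam A a ν r e c ∈ Noise n T a :=
    pushNoise_mem hν ha r he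
  have hp := hmem (c := 1) (by simp)
  have hm := hmem (c := -1) (by simp)
  have hpre : ∀ c, ∀ i < r, pushNoise lam A a ν r e c i = ν i := fun c i hi => if_pos hi
  have hout : (fun i : Fin (t + 1) => chOut lam A f.U (pushNoise lam A a ν r e 1) i) =
      fun i : Fin (t + 1) => chOut lam A f.U (pushNoise lam A a ν r e (-1)) i := by
    funext i
    have hi : (i : ℕ) ≤ t := Nat.lt_succ_iff.1 i.2
    simp only [chOut, hfresh _ hp (hpre _) i hi, hfresh _ hm (hpre _) i hi]
    rcases lt_or_ge (i : ℕ) r with h | h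
    · rw [srcX_pushNoise_of_lt ν h, srcX_pushNoise_of_lt ν h]
    · simp [hsilent i h hi]
  have h1 := hD _ hp t ht
  have h2 := hD _ hm t ht
  rw [← hout] at h2
  have h3 := norm_sub_le_norm_sub_add_norm_sub (srcX lam A (pushNoise lam A a ν r e 1) t)
    (g t fun i => chOut lam A f.U (pushNoise lam A a ν r e 1) i)
    (srcX lam A (pushNoise lam A a ν r e (-1)) t)
  rw [srcX_pushNoise_sub ν e hr hrt fun i h h' => hsilent i h h'.le, norm_smul, norm_direction,
    he, Real.norm_eq_abs, abs_of_nonneg (mul_nonneg zero_le_two (Xd_nonneg ha _ _)),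
    norm_sub_rev (g t _)] at h3
  linarith

/-- A noise realization along which the sensor always transmits as early as possible. -/
lemma exists_earliest_noise (hn : 1 ≤ n) (ha : ∀ t, 0 ≤ a t) {f : TxStrategy lam A T K}
    {g : EstStrategy n} {D : ℝ}
    (hD : ∀ ν ∈ Noise n T a, ∀ t < T,
      ‖srcX lam A ν t - g t (fun i => chOut lam A f.U ν i)‖ ≤ D) {t : ℕ} (ht : t ≤ T) :
    ∃ ν ∈ Noise n T a, (∀ i < t, f.U ν i = false → Xd lam a (f.U ν) i ≤ D) ∧
      ∃ r ≤ t, (∀ j, j + 1 = r → f.U ν j = true) ∧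
        (∀ i, r ≤ i → i < t → f.U ν i = false) ∧
        ∀ ν' ∈ Noise n T a, (∀ i < r, ν' i = ν i) → ∀ i < t, f.U ν' i = f.U ν i := by
  induction t with
  | zero => exact ⟨0, fun t _ => by simpa using ha t, by simp, 0, le_rfl, by simp⟩
  | succ t ih =>
    obtain ⟨ν, hν, hle, r, hrt, hr, hsilent, hfresh⟩ := ih (by omega)
    by_cases hex : ∃ ν' ∈ Noise n T a, (∀ i < r, ν' i = ν i) ∧ f.U ν' t = true
    · obtain ⟨ν', hν', hpre, htx⟩ := hex
      have hU := hfresh ν' hν' hpre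
      refine ⟨ν', hν', fun i hi hui => ?_, t + 1, le_rfl, fun j hj => ?_, by omega,
        fun ν'' _ h i hi => f.adapted _ _ _ (by omega) fun j hj =>
          srcX_congr fun k hk => h k (by omega)⟩
      · have hit : i < t := by
          refine lt_of_le_of_ne (Nat.lt_succ_iff.1 hi) ?_
          rintro rfl
          simp [htx] at hui
        rw [Xd_congr fun j hj => hU j (hj.trans hit)]
        exact hle i hit (hU i hit ▸ hui)
      · rwa [Nat.succ_injective hj]
    · push Not at hex
      simp only [ne_eq, Bool.not_eq_true] at hex
      have hut := hex ν hν fun _ _ => rfl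
      have hsilent' : ∀ i, r ≤ i → i ≤ t → f.U ν i = false := fun i h h' =>
        h'.lt_or_eq.elim (hsilent i h) fun h => h ▸ hut
      have hfresh' : ∀ ν' ∈ Noise n T a, (∀ i < r, ν' i = ν i) →
          ∀ i ≤ t, f.U ν' i = f.U ν i := fun ν' hν' h i hi =>
        hi.lt_or_eq.elim (hfresh ν' hν' h i) fun h' => by rw [h', hut, hex ν' hν' h]
      refine ⟨ν, hν, fun i hi hui => ?_, r, by omega, hr,
        fun i h h' => hsilent' i h (Nat.lt_succ_iff.1 h'),
        fun ν' hν' h i hi => hfresh' ν' hν' h i (Nat.lt_succ_iff.1 hi)⟩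
      rcases (Nat.lt_succ_iff.1 hi).lt_or_eq with h | rfl
      · exact hle i h hui
      · exact Xd_le_of_silent hn ha hD hν hrt ht hr hsilent' hfresh'

lemma TxStrategy.adm (f : TxStrategy lam A T K) (ν : ℕ → Euc n) : Adm T K (f.U ν) := by
  have key : ∀ t ≤ T, (∑ i ∈ Finset.range t, (if f.U ν i then 1 else 0)) ≤ K := by
    intro t
    induction t with
    | zero => simp
    | succ t ih =>
      intro ht
      rw [Finset.sum_range_succ]
      split_ifs with h
      · exact f.energy_ok ν t ht h
      · exact ih (by omega)
  exact key T le_rfl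

lemma exists_control_le_Jcost (hn : 1 ≤ n) (hT : 1 ≤ T) (ha : ∀ t, 0 ≤ a t)
    (f : TxStrategy lam A T K) (g : EstStrategy n) :
    ∃ u, Adm T K u ∧ ENNReal.ofReal (Jd lam a T u) ≤ Jcost lam A T K a f g := by
  by_cases htop : Jcost lam A T K a f g = ⊤
  · exact ⟨f.U 0, f.adm 0, htop ▸ le_top⟩
  have hD : ∀ ν ∈ Noise n T a, ∀ t < T,
      ‖srcX lam A ν t - g t (fun i => chOut lam A f.U ν i)‖ ≤
        (Jcost lam A T K a f g).toReal := fun ν hν t ht =>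
    (ENNReal.ofReal_le_iff_le_toReal htop).1 <|
      le_iSup₂_of_le ν hν (le_iSup_of_le ⟨t, ht⟩ le_rfl)
  obtain ⟨ν, -, hle, -⟩ := exists_earliest_noise hn ha hD le_rfl
  refine ⟨f.U ν, f.adm ν, (ENNReal.ofReal_le_iff_le_toReal htop).2 ?_⟩
  have : Nonempty (Fin T) := ⟨⟨0, hT⟩⟩
  refine ciSup_le fun t => ?_
  split_ifs with h
  · exact ENNReal.toReal_nonneg
  · exact hle t t.2 (by simpa using h)

end LowerBound

/-- the infimum of `J(f,g)` over all pairs is attained and equals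
the minimum of `J^d(u)` over admissible control sequences `u`. -/
theorem stmt12 {n : ℕ} (hn : 1 ≤ n) (lam : ℝ) (A : Euc n ≃ₗᵢ[ℝ] Euc n)
    (T K : ℕ) (hT : 1 ≤ T) (hK : 1 ≤ K) (hKT : K < T)
    (a : ℕ → ℝ) (ha : ∀ t, 0 ≤ a t) :
    (∃ (f : TxStrategy lam A T K) (g : EstStrategy n),
      Jcost lam A T K a f g =
        ⨅ (f' : TxStrategy lam A T K) (g' : EstStrategy n), Jcost lam A T K a f' g') ∧
    ∃ u : ℕ → Bool, Adm T K u ∧ (∀ u', Adm T K u' → Jd lam a T u ≤ Jd lam a T u') ∧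
      (⨅ (f' : TxStrategy lam A T K) (g' : EstStrategy n), Jcost lam A T K a f' g') =
        ENNReal.ofReal (Jd lam a T u) := by
  obtain ⟨u, hu, hmin⟩ := exists_optimal_control lam a T K
  have hlower : ENNReal.ofReal (Jd lam a T u) ≤
      ⨅ (f' : TxStrategy lam A T K) (g' : EstStrategy n), Jcost lam A T K a f' g' :=
    le_iInf₂ fun f g => by
      obtain ⟨v, hv, hle⟩ := exists_control_le_Jcost hn hT ha f g
      exact (ENNReal.ofReal_le_ofReal (hmin v hv)).trans hle
  have hupper := Jcost_openLoop_le (lam := lam) (A := A) (a := a) hu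
  exact ⟨⟨openLoopTx lam A hu, propagateEst lam A,
      le_antisymm (hupper.trans hlower) (iInf₂_le _ _)⟩,
    u, hu, hmin, le_antisymm ((iInf₂_le _ _).trans hupper) hlower⟩
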